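/- Let t and k be integers with 4 ≤ t and t+2 ≤ k, and let τ be a Motzkin permutation of length k of the form τ = (ρ', t, k, θ', 1, t−1), where ρ' is a rearrangement of {t+1,…,k−1} (so every entry of ρ' exceeds t) and θ' is a rearrangement of {2,…,t−2} (so every entry of θ' is less than t−1). Let ρ be the Motzkin permutation of length k−t−1 obtained from ρ' by decreasing each entry by t, and θ the Motzkin permutation of length t−3 obtained from θ' by decreasing each entry by 1. Let W(x) be the formal power series determined by W(x)·(1 − x − x²·N_θ(x)) = 1. Then N_τ(x)·(1 − x − x²·(N_ρ(x) + W(x))) = 1 − x²·N_ρ(x)·W(x). -/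

import Mathlib

/-- `π` avoids the classical pattern 132. -/
def Avoids132 {n : ℕ} (π : Equiv.Perm (Fin n)) : Prop :=
  ¬ ∃ i j k : Fin n, i < j ∧ j < k ∧ π i < π k ∧ π k < π j

/-- `π` avoids the generalized pattern 1-23. -/
def Avoids1_23 {n : ℕ} (π : Equiv.Perm (Fin n)) : Prop :=
  ¬ ∃ (a b : Fin n) (h : (b : ℕ) + 1 < n), a < b ∧ π a < π b ∧ π b < π ⟨(b : ℕ) + 1, h⟩

/-- A Motzkin permutation avoids both 132 and 1-23. -/
def IsMotzkinPerm {n : ℕ} (π : Equiv.Perm (Fin n)) : Prop :=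
  Avoids132 π ∧ Avoids1_23 π

/-- `π` contains the classical pattern `τ`. -/
def ContainsPatt {k n : ℕ} (τ : Equiv.Perm (Fin k)) (π : Equiv.Perm (Fin n)) : Prop :=
  ∃ f : Fin k → Fin n, StrictMono f ∧ ∀ i j : Fin k, τ i < τ j ↔ π (f i) < π (f j)

/-- `Ngf τ` is the generating function `∑_n |𝔐_n(τ)| xⁿ` for Motzkin permutations
avoiding the classical pattern `τ`. -/
noncomputable def Ngf {k : ℕ} (τ : Equiv.Perm (Fin k)) : PowerSeries ℚ :=
  PowerSeries.mk fun n =>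
    (Nat.card {π : Equiv.Perm (Fin n) // IsMotzkinPerm π ∧ ¬ ContainsPatt τ π} : ℚ)

/-- Motzkin trees. -/
inductive MT : Type
  | nil : MT
  | c : MT → MT
  | p : MT → MT → MT

namespace MT

def size : MT → ℕ
  | nil => 0
  | c a => size a + 1
  | p a b => size a + size b + 2

def word : MT → ℕ → List ℕ
  | nil, _ => []
  | c a, o => (o + size a) :: word a o
  | p a b, o =>
    (word a (o + size b + 1) ++ [o + size b, o + size b + 1 + size a]) ++ word b o

def Motz : List ℕ → Prop
  | [] => True
  | x :: l => l.Pairwise (fun b c => ¬ (x < c ∧ c < b)) ∧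
      l.IsChain (fun b c => ¬ (x < b ∧ b < c)) ∧ Motz l

def Cont (p l : List ℕ) : Prop :=
  ∃ f : ℕ → ℕ, (∀ x ∈ p, ∀ y ∈ p, x < y → f x < f y) ∧ (p.map f).Sublist l

def Iv (l : List ℕ) (a b : ℕ) : Prop := l.Nodup ∧ ∀ x, x ∈ l ↔ a ≤ x ∧ x < b

theorem Iv.length {l : List ℕ} {a b : ℕ} (h : Iv l a b) : l.length = b - a := by
  rw [← List.toFinset_card_of_nodup h.1, ← Nat.card_Ico]
  congr 1
  ext x
  simp [h.2]

theorem word_iv (T : MT) : ∀ o, Iv (word T o) o (o + size T) := by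
  induction T with
  | nil => intro o; constructor <;> simp [word, size]
  | c a ih =>
    intro o
    obtain ⟨h1, h2⟩ := ih o
    constructor
    · simp [word, h1, h2]
    · intro x; simp [word, h2, size]; omega
  | p a b iha ihb =>
    intro o
    obtain ⟨h1, h2⟩ := iha (o + size b + 1)
    obtain ⟨h3, h4⟩ := ihb o
    constructor
    · simp [word, List.nodup_append, h1, h3, h2, h4]
      refine ⟨by omega, fun x hx hx' => ⟨by omega, by omega, fun y _ hy => by omega⟩⟩
    · intro x; simp [word, h2, h4, size]; omega

theorem word_length (T : MT) (o : ℕ) : (word T o).length = size T := by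
  rw [(word_iv T o).length]; omega

theorem word_shift (T : MT) (d : ℕ) : ∀ o, word T (o + d) = (word T o).map (· + d) := by
  induction T with
  | nil => intro o; simp [word]
  | c a ih => intro o; simp [word, ih]; omega
  | p a b iha ihb =>
    intro o
    have := iha (o + size b + 1)
    simp [word, ihb, ← this]
    have e1 : o + d + size b = o + size b + d := by omega
    have e2 : o + d + size b + 1 = o + size b + 1 + d := by omega
    have e3 : o + size b + 1 + d + size a = o + size b + 1 + size a + d := by omega
    rw [e2, e1, e3]

theorem cont_word (q : List ℕ) (T : MT) (o : ℕ) : Cont q (word T o) ↔ Cont q (word T 0) := by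
  have h := word_shift T o 0
  rw [Nat.zero_add] at h
  constructor
  · rintro ⟨f, hf, hs⟩
    refine ⟨fun x => f x - o, ?_, ?_⟩
    · intro x hx y hy hxy
      have := hf x hx y hy hxy
      have h1 : f x ∈ word T o := hs.subset (List.mem_map_of_mem hx)
      have h2 := ((word_iv T o).2 _).1 h1
      show f x - o < f y - o
      omega
    · have := hs.map (fun x => x - o)
      rw [h, List.map_map, List.map_map] at this
      simpa [Function.comp_def] using this
  · rintro ⟨f, hf, hs⟩
    refine ⟨fun x => f x + o, ?_, ?_⟩
    · intro x hx y hy hxy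
      have := hf x hx y hy hxy
      show f x + o < f y + o
      omega
    · have := hs.map (fun x => x + o)
      rw [← h, List.map_map] at this
      exact this

theorem motz_append {P Q : List ℕ} (h : ∀ x ∈ P, ∀ y ∈ Q, y < x) (hP : Motz P) (hQ : Motz Q) :
    Motz (P ++ Q) := by
  induction P with
  | nil => simpa
  | cons x P ih =>
    obtain ⟨h1, h2, h3⟩ := hP
    have hx : ∀ y ∈ Q, y < x := h x (by simp)
    refine ⟨?_, ?_, ih (fun x hx => h x (by simp [hx])) h3⟩
    · apply List.pairwise_append.2
      refine ⟨h1, ?_, ?_⟩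
      · apply List.Pairwise.imp_of_mem (R := fun _ _ => True)
        · intro a b ha hb _ hab
          have := hx b hb; omega
        · exact List.pairwise_of_forall (fun _ _ => trivial)
      · intro a ha b hb hab
        have := hx b hb; omega
    · apply List.isChain_append.2
      refine ⟨h2, ?_, ?_⟩
      · apply List.Pairwise.isChain
        apply List.Pairwise.imp_of_mem (R := fun _ _ => True)
        · intro a b ha hb _ hab
          have := hx a ha; omega
        · exact List.pairwise_of_forall (fun _ _ => trivial)
      · intro a ha b hb hab
        have := hx b (List.mem_of_mem_head? hb); omega

theorem motz_mM {α : List ℕ} {m M : ℕ} (h : ∀ x ∈ α, m < x ∧ x < M) (hP : Motz α) :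
    Motz (α ++ [m, M]) := by
  induction α with
  | nil => simp [Motz]
  | cons x P ih =>
    obtain ⟨h1, h2, h3⟩ := hP
    have hx := h x (by simp)
    refine ⟨?_, ?_, ih (fun x hx => h x (by simp [hx])) h3⟩
    · apply List.pairwise_append.2
      refine ⟨h1, ?_, ?_⟩
      · simp; omega
      · intro a ha b hb hab
        have := h a (by simp [ha])
        simp at hb
        omega
    · apply List.isChain_append.2
      refine ⟨h2, ?_, ?_⟩
      · simp; omega
      · intro a ha b hb hab
        simp at hb
        omega

theorem motz_cons {α : List ℕ} {M : ℕ} (h : ∀ x ∈ α, x < M) (hP : Motz α) :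
    Motz (M :: α) :=
  motz_append (P := [M]) (by simpa using h) (by simp [Motz]) hP

theorem motz_word (T : MT) : ∀ o, Motz (word T o) := by
  induction T with
  | nil => intro o; simp [word, Motz]
  | c a ih =>
    intro o
    exact motz_cons (fun x hx => (((word_iv a o).2 x).1 hx).2) (ih o)
  | p a b iha ihb =>
    intro o
    apply motz_append
    · intro x hx y hy
      have h2 := ((word_iv b o).2 y).1 hy
      rcases List.mem_append.1 hx with hx | hx
      · have := ((word_iv a _).2 x).1 hx; omega
      · simp at hx; omega
    · apply motz_mM _ (iha _)
      intro x hx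
      have := ((word_iv a _).2 x).1 hx; omega
    · exact ihb o

theorem motz_of_append {P Q : List ℕ} (h : Motz (P ++ Q)) : Motz P ∧ Motz Q := by
  induction P with
  | nil => exact ⟨trivial, h⟩
  | cons x P ih =>
    obtain ⟨h1, h2, h3⟩ := h
    exact ⟨⟨(List.pairwise_append.1 h1).1, (List.isChain_append.1 h2).1, (ih h3).1⟩, (ih h3).2⟩

theorem motz_gt {P Q : List ℕ} {M : ℕ} (h : Motz (P ++ M :: Q)) :
    ∀ x ∈ P, ∀ y ∈ Q, ¬ (x < y ∧ y < M) := by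
  induction P with
  | nil => simp
  | cons x P ih =>
    obtain ⟨h1, h2, h3⟩ := h
    intro a ha
    rcases List.mem_cons.1 ha with rfl | ha
    · have := (List.pairwise_append.1 h1).2.1
      exact (List.pairwise_cons.1 this).1
    · exact ih h3 a ha

theorem motz_min {P Q : List ℕ} {m M : ℕ} (h : Motz (P ++ m :: M :: Q)) :
    ∀ x ∈ P, ¬ (x < m ∧ m < M) := by
  induction P with
  | nil => simp
  | cons x P ih =>
    obtain ⟨h1, h2, h3⟩ := h
    intro a ha
    rcases List.mem_cons.1 ha with rfl | ha
    · have := (List.isChain_append.1 h2).2.1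
      exact (List.isChain_cons_cons.1 this).1
    · exact ih h3 a ha

theorem exists_tree (n : ℕ) : ∀ (o : ℕ) (l : List ℕ), Iv l o (o + n) → Motz l →
    ∃ T, size T = n ∧ word T o = l := by
  induction n using Nat.strong_induction_on with
  | _ n ih =>
    intro o l hl hm
    rcases Nat.eq_zero_or_pos n with rfl | hn
    · refine ⟨nil, rfl, ?_⟩
      have := hl.length
      symm
      apply List.eq_nil_of_length_eq_zero
      omega
    · have hM : o + n - 1 ∈ l := by rw [hl.2]; omega
      obtain ⟨A, β, rfl⟩ := List.append_of_mem hM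
      obtain ⟨hnd, hmem⟩ := hl
      rcases List.eq_nil_or_concat' A with rfl | ⟨α, m, rfl⟩
      · have hβ : Iv β o (o + (n - 1)) := by
          simp at hnd hmem
          refine ⟨hnd.2, fun x => ?_⟩
          have := hmem x
          constructor
          · intro hx
            have h1 := this.1 (Or.inr hx)
            have : x ≠ o + n - 1 := by rintro rfl; exact hnd.1 hx
            omega
          · intro hx
            rcases this.2 (by omega) with h | h
            · omega
            · exact h
        obtain ⟨T, hT, hw⟩ := ih (n - 1) (by omega) o β hβ (motz_of_append (P := [_]) hm).2
        refine ⟨c T, by simp [size]; omega, ?_⟩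
        simp [word, hw]; omega
      · have g1 := motz_gt hm
        simp only [List.append_assoc, List.singleton_append] at hm g1 hnd hmem
        have g2 := motz_min hm
        have hmα := (motz_of_append hm).1
        have hmβ := (motz_of_append (P := [_, _]) (motz_of_append hm).2).2
        simp [List.nodup_append] at hnd hmem g1
        obtain ⟨hα, ⟨⟨mM, mβ⟩, Mβ, ndβ⟩, hne⟩ := hnd
        have e1 : ∀ x ∈ β, x < m := by
          intro x hx
          have h1 := g1 m (Or.inr rfl) x hx
          have h2 := (hmem x).1 (by simp [hx])
          have h3 : x ≠ m := by rintro rfl; exact mβ hx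
          have h4 : x ≠ o + n - 1 := by rintro rfl; exact Mβ hx
          omega
        have hm' := (hmem m).1 (by simp)
        have e2 : ∀ x ∈ α, m < x ∧ x < o + n - 1 := by
          intro x hx
          have h1 := g2 x hx
          have h2 := (hmem x).1 (by simp [hx])
          have h3 := hne x hx
          omega
        have iβ : Iv β o (o + (m - o)) := by
          refine ⟨ndβ, fun x => ⟨fun hx => ?_, fun hx => ?_⟩⟩
          · have := e1 x hx
            have h2 := (hmem x).1 (by simp [hx])
            omega
          · rcases (hmem x).2 (by omega) with h | h | h | h
            · have := e2 x h; omega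
            · omega
            · omega
            · exact h
        have iα : Iv α (m + 1) (m + 1 + (o + n - 1 - (m + 1))) := by
          refine ⟨hα, fun x => ⟨fun hx => ?_, fun hx => ?_⟩⟩
          · have := e2 x hx
            omega
          · rcases (hmem x).2 (by omega) with h | h | h | h
            · exact h
            · omega
            · omega
            · have := e1 x h; omega
        obtain ⟨T, hT, hw⟩ := ih _ (by omega) o β iβ hmβ
        obtain ⟨S, hS, hwS⟩ := ih _ (by omega) (m+1) α iα hmα
        refine ⟨p S T, by simp [size]; omega, ?_⟩
        have e3 : o + size T = m := by omega
        have e4 : m + 1 + size S = o + n - 1 := by omega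
        simp [word, e3, e4, hwS, hw]

theorem word_inj (S : MT) : ∀ (T : MT) (o : ℕ), word S o = word T o → S = T := by
  have hsz : ∀ (S T : MT) (o : ℕ), word S o = word T o → size S = size T := by
    intro S T o h
    rw [← word_length S o, ← word_length T o, h]
  induction S with
  | nil =>
    intro T o h
    cases T <;> simp [word] at h ⊢
  | c a ih =>
    intro T o h
    have hs := hsz _ _ _ h
    cases T with
    | nil => simp [word] at h
    | c b =>
      simp [word] at h
      rw [ih b o h.2]
    | p a' b' =>
      exfalso
      simp only [size] at hs
      simp only [word] at h
      have iv := word_iv a' (o + size b' + 1)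
      cases hw : word a' (o + size b' + 1) with
      | nil => simp [hw] at h; omega
      | cons x l =>
        simp [hw] at h
        have := (iv.2 x).1 (by simp [hw])
        omega
  | p a b iha ihb =>
    intro T o h
    have hs := hsz _ _ _ h
    cases T with
    | nil => simp [word] at h
    | c b' =>
      exfalso
      simp only [size] at hs
      simp only [word] at h
      have iv := word_iv a (o + size b + 1)
      cases hw : word a (o + size b + 1) with
      | nil => simp [hw] at h; omega
      | cons x l =>
        simp [hw] at h
        have := (iv.2 x).1 (by simp [hw])
        omega
    | p a' b' =>
      simp only [size] at hs
      simp only [word] at h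
      have e : o + size b + 1 + size a = o + size b' + 1 + size a' := by omega
      rw [e] at h
      have k1 : o + size b' + 1 + size a' ∉ word a (o + size b + 1) ++ [o + size b] := by
        intro hx
        simp [(word_iv _ _).2] at hx
        omega
      have k2 : o + size b' + 1 + size a' ∉ word a' (o + size b' + 1) ++ [o + size b'] := by
        intro hx
        simp [(word_iv _ _).2] at hx
        omega
      have h' : (word a (o + size b + 1) ++ [o + size b]) ++ (o + size b' + 1 + size a') :: word b o
        = (word a' (o + size b' + 1) ++ [o + size b']) ++ (o + size b' + 1 + size a') :: word b' o := by
        simpa using h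
      have h3 : (word a (o + size b + 1) ++ [o + size b]) = (word a' (o + size b' + 1) ++ [o + size b']) ∧ word b o = word b' o := by
        rw [List.append_eq_append_iff] at h'
        rcases h' with ⟨as, h1, h2⟩ | ⟨as, h1, h2⟩
        · cases as with
          | nil => simp at h2; simp [h1, h2]
          | cons y as =>
            simp at h2
            exact absurd (by rw [h1]; simp [h2.1]) k2
        · cases as with
          | nil => simp at h2; simp [h1, h2]
          | cons y as =>
            simp at h2
            exact absurd (by rw [h1]; simp [h2.1]) k1
      have hb := ihb _ _ h3.2
      subst hb
      have ha := iha _ _ (List.append_inj_left' h3.1 rfl)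
      rw [ha]

end MT
namespace MT

theorem snoc_sub {s l : List ℕ} {x y : ℕ} (h : (s ++ [x]).Sublist (l ++ [y])) :
    (s ++ [x]).Sublist l ∨ (x = y ∧ s.Sublist l) := by
  rw [List.sublist_append_iff] at h
  obtain ⟨a, b, hab, h1, h2⟩ := h
  rw [List.sublist_singleton] at h2
  rcases h2 with rfl | rfl
  · left; rw [hab]; simpa using h1
  · right
    have := List.append_inj' hab rfl
    simp at this
    rw [this.1]; exact ⟨this.2, h1⟩

theorem snoc_sub' {s l : List ℕ} {x y : ℕ} (h : (s ++ [x]).Sublist (l ++ [y])) :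
    s.Sublist l := by
  rcases snoc_sub h with h | h
  · exact (List.sublist_append_left _ _).trans h
  · exact h.2

theorem cont_mono {q l l' : List ℕ} (h : Cont q l) (hl : l.Sublist l') : Cont q l' := by
  obtain ⟨f, hf, hs⟩ := h
  exact ⟨f, hf, hs.trans hl⟩

theorem cont_sub {q q' l : List ℕ} (h : Cont q l) (hl : q'.Sublist q) : Cont q' l := by
  obtain ⟨f, hf, hs⟩ := h
  exact ⟨f, fun x hx y hy => hf x (hl.subset hx) y (hl.subset hy), (hl.map f).trans hs⟩

theorem cont_shift (q l : List ℕ) (d : ℕ) : Cont (q.map (· + d)) l ↔ Cont q l := by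
  constructor
  · rintro ⟨f, hf, hs⟩
    refine ⟨fun x => f (x + d), ?_, by simpa [Function.comp_def] using hs⟩
    intro x hx y hy hxy
    exact hf _ (List.mem_map_of_mem hx) _ (List.mem_map_of_mem hy) (by simpa)
  · rintro ⟨f, hf, hs⟩
    refine ⟨fun x => f (x - d), ?_, by simpa [Function.comp_def] using hs⟩
    intro x hx y hy hxy
    simp at hx hy
    obtain ⟨x, hx, rfl⟩ := hx
    obtain ⟨y, hy, rfl⟩ := hy
    simpa using hf x hx y hy (by omega)

/-- pattern not starting with its max -/
theorem cont_cons {q l : List ℕ} {x y M : ℕ} (hy : y ∈ q) (hxy : x < y) (hM : ∀ z ∈ l, z < M) :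
    Cont (x :: q) (M :: l) ↔ Cont (x :: q) l := by
  constructor
  · rintro ⟨f, hf, hs⟩
    refine ⟨f, hf, ?_⟩
    rw [List.map_cons] at hs ⊢
    cases hs with
    | cons _ h => exact h
    | cons_cons _ h =>
      exfalso
      have h1 := hM _ (h.subset (List.mem_map_of_mem hy))
      have h2 := hf x (by simp) y (by simp [hy]) hxy
      omega
  · intro h; exact cont_mono h (by simp)

theorem split_aux {A B P s1 s2 : List ℕ} {hi : ℕ} {f : ℕ → ℕ} (hAB : ∀ x ∈ A, ∀ y ∈ B, y < x)
    (hP : ∀ x ∈ P, x < hi) (hf : ∀ x ∈ P ++ [hi], ∀ y ∈ P ++ [hi], x < y → f x < f y)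
    (e : (P ++ [hi]).map f = s1 ++ s2) (h1 : s1.Sublist A) (h2 : s2.Sublist B) :
    s1 = [] ∨ s2 = [] := by
  rcases List.eq_nil_or_concat' s2 with rfl | ⟨s, z, rfl⟩
  · right; rfl
  · left
    rw [List.map_append, ← List.append_assoc] at e
    have e2 := List.append_inj' e rfl
    simp at e2
    cases s1 with
    | nil => rfl
    | cons w s1 =>
      exfalso
      have hw : w ∈ A := h1.subset (by simp)
      have hz : z ∈ B := h2.subset (by simp)
      have := hAB w hw z hz
      have hwP : w ∈ P.map f := by rw [e2.1]; simp
      obtain ⟨x, hx, rfl⟩ := List.mem_map.1 hwP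
      have := hf x (by simp [hx]) hi (by simp) (hP x hx)
      omega

theorem cont_indec {A B P : List ℕ} {hi : ℕ} (hAB : ∀ x ∈ A, ∀ y ∈ B, y < x)
    (hP : ∀ x ∈ P, x < hi) :
    Cont (P ++ [hi]) (A ++ B) ↔ Cont (P ++ [hi]) A ∨ Cont (P ++ [hi]) B := by
  constructor
  · rintro ⟨f, hf, hs⟩
    obtain ⟨s1, s2, e, h1, h2⟩ := List.sublist_append_iff.1 hs
    rcases split_aux hAB hP hf e h1 h2 with rfl | rfl
    · right; exact ⟨f, hf, by rw [e]; simpa using h2⟩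
    · left; exact ⟨f, hf, by rw [e]; simpa using h1⟩
  · rintro (h | h)
    · exact cont_mono h (by simp)
    · exact cont_mono h (by simp)

theorem cont_skew {A B P Q : List ℕ} {hi hj : ℕ} (hAB : ∀ x ∈ A, ∀ y ∈ B, y < x)
    (hP : ∀ x ∈ P, x < hi) (hQ : ∀ x ∈ Q, x < hj)
    (hPQ : ∀ x ∈ P ++ [hi], ∀ y ∈ Q ++ [hj], y < x) :
    Cont ((P ++ [hi]) ++ (Q ++ [hj])) (A ++ B) ↔
      Cont ((P ++ [hi]) ++ (Q ++ [hj])) A ∨ (Cont (P ++ [hi]) A ∧ Cont (Q ++ [hj]) B) ∨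
      Cont ((P ++ [hi]) ++ (Q ++ [hj])) B := by
  constructor
  · rintro ⟨f, hf, hs⟩
    obtain ⟨s1, s2, e, h1, h2⟩ := List.sublist_append_iff.1 hs
    have hfP : ∀ x ∈ P ++ [hi], ∀ y ∈ P ++ [hi], x < y → f x < f y :=
      fun x hx y hy => hf x (List.mem_append_left _ hx) y (List.mem_append_left _ hy)
    have hfQ : ∀ x ∈ Q ++ [hj], ∀ y ∈ Q ++ [hj], x < y → f x < f y :=
      fun x hx y hy => hf x (List.mem_append_right _ hx) y (List.mem_append_right _ hy)
    have e' := e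
    rw [List.map_append, List.append_eq_append_iff] at e'
    rcases e' with ⟨c, e1, e2⟩ | ⟨c, e1, e2⟩
    · have hc : c.Sublist A := by
        refine List.Sublist.trans ?_ h1
        rw [e1]; simp
      have hPA : ((P ++ [hi]).map f).Sublist A := by
        refine List.Sublist.trans ?_ h1
        rw [e1]; exact List.sublist_append_left _ _
      rcases split_aux hAB hQ hfQ e2 hc h2 with rfl | rfl
      · right; left
        exact ⟨⟨f, hfP, hPA⟩, f, hfQ, by rw [e2]; simpa using h2⟩
      · left
        exact ⟨f, hf, by rw [e]; simpa using h1⟩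
    · have hc : c.Sublist B := by
        refine List.Sublist.trans ?_ h2
        rw [e2]; simp
      have hPA : ((Q ++ [hj]).map f).Sublist B := by
        refine List.Sublist.trans ?_ h2
        rw [e2]; exact List.sublist_append_right _ _
      rcases split_aux hAB hP hfP e1 h1 hc with rfl | rfl
      · right; right
        exact ⟨f, hf, by rw [e]; simpa using h2⟩
      · right; left
        exact ⟨⟨f, hfP, by rw [e1]; simpa using h1⟩, f, hfQ, hPA⟩
  · rintro (h | ⟨⟨f, hf, hfs⟩, g, hg, hgs⟩ | h)
    · exact cont_mono h (by simp)
    · refine ⟨fun x => if x ∈ Q ++ [hj] then g x else f x, ?_, ?_⟩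
      · intro x hx y hy hxy
        have hnP : ∀ z ∈ P ++ [hi], z ∉ Q ++ [hj] := by
          intro z hz hz'
          exact lt_irrefl _ (hPQ z hz z hz')
        rcases List.mem_append.1 hx with hx | hx <;> rcases List.mem_append.1 hy with hy | hy
        · simp only [hnP x hx, hnP y hy, if_false]
          exact hf x hx y hy hxy
        · have := hPQ x hx y hy; omega
        · simp only [hnP y hy, hx, if_false, if_true]
          exact hAB _ (hfs.subset (List.mem_map_of_mem hy)) _ (hgs.subset (List.mem_map_of_mem hx))
        · simp only [hx, hy, if_true]
          exact hg x hx y hy hxy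
      · rw [List.map_append]
        have e1 : (P ++ [hi]).map (fun x => if x ∈ Q ++ [hj] then g x else f x)
            = (P ++ [hi]).map f := by
          apply List.map_congr_left
          intro x hx
          rw [if_neg]
          intro hx'
          exact lt_irrefl _ (hPQ x hx x hx')
        have e2 : (Q ++ [hj]).map (fun x => if x ∈ Q ++ [hj] then g x else f x)
            = (Q ++ [hj]).map g := by
          apply List.map_congr_left
          intro x hx
          rw [if_pos hx]
        rw [e1, e2]
        exact hfs.append hgs
    · exact cont_mono h (by simp)

theorem cont_mM {u α : List ℕ} {lo hi m M : ℕ} (hu : ∀ x ∈ u, lo < x ∧ x < hi) (hlh : lo < hi)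
    (hα : ∀ x ∈ α, m < x ∧ x < M) (hmM : m < M) :
    Cont (u ++ [lo, hi]) (α ++ [m, M]) ↔ Cont u α := by
  constructor
  · rintro ⟨f, hf, hs⟩
    refine ⟨f, fun x hx y hy => hf x (by simp [hx]) y (by simp [hy]), ?_⟩
    have e : ∀ (l : List ℕ) (a b : ℕ), l ++ [a, b] = (l ++ [a]) ++ [b] := by
      intro l a b
      simp
    rw [List.map_append, List.map_cons, List.map_cons, List.map_nil, e, e] at hs
    exact snoc_sub' (snoc_sub' hs)
  · rintro ⟨f, hf, hs⟩
    have hfm : ∀ x ∈ u, m < f x ∧ f x < M := fun x hx => hα _ (hs.subset (List.mem_map_of_mem hx))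
    refine ⟨fun x => if x = lo then m else if x = hi then M else f x, ?_, ?_⟩
    · intro x hx y hy hxy
      simp at hx hy
      rcases hx with hx | rfl | rfl <;> rcases hy with hy | rfl | rfl
      · have h1 := hu x hx
        have h2 := hu y hy
        simp only [h1.1.ne', h2.1.ne', h1.2.ne, h2.2.ne, if_false]
        exact hf x hx y hy hxy
      · have := hu x hx; omega
      · have h1 := hu x hx
        simp only [h1.1.ne', h1.2.ne, hlh.ne', if_false, if_true]
        exact (hfm x hx).2
      · have h2 := hu y hy
        simp only [h2.1.ne', h2.2.ne, if_false, if_true]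
        exact (hfm y hy).1
      · omega
      · simp only [hlh.ne', if_false, if_true]
        exact hmM
      · have := hu y hy; omega
      · omega
      · omega
    · have e1 : u.map (fun x => if x = lo then m else if x = hi then M else f x) = u.map f := by
        apply List.map_congr_left
        intro x hx
        have h1 := hu x hx
        rw [if_neg h1.1.ne', if_neg h1.2.ne]
      rw [List.map_append, e1]
      simp only [List.map_cons, List.map_nil, if_true, hlh.ne', if_false]
      exact hs.append (List.Sublist.refl _)

theorem cont_mM' {u α : List ℕ} {x y z m M : ℕ} (hy : y ∈ u) (hxy : x < y) (hz : z ∈ u)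
    (hzx : z < x) (hα : ∀ x ∈ α, m < x ∧ x < M) (hmM : m < M) :
    Cont (u ++ [x]) (α ++ [m, M]) ↔ Cont (u ++ [x]) α := by
  constructor
  · rintro ⟨f, hf, hs⟩
    refine ⟨f, hf, ?_⟩
    rw [List.map_append, List.map_cons, List.map_nil] at hs ⊢
    have h1 := hf x (by simp) y (by simp [hy]) hxy
    have h2 := hf z (by simp [hz]) x (by simp) hzx
    have e : α ++ [m, M] = (α ++ [m]) ++ [M] := by simp
    rw [e] at hs
    rcases snoc_sub hs with h | ⟨h, h'⟩
    · rcases snoc_sub h with h | ⟨h, h'⟩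
      · exact h
      · have := hα _ (h'.subset (List.mem_map_of_mem hz))
        omega
    · have := h'.subset (List.mem_map_of_mem hy)
      simp at this
      rcases this with h3 | h3
      · have := hα (f y) (by simpa using h3)
        omega
      · omega
  · intro h; exact cont_mono h (by simp)

theorem word_lt (T : MT) (o x : ℕ) (h : x ∈ word T o) : o ≤ x ∧ x < o + size T :=
  ((word_iv T o).2 x).1 h

theorem pairAB (a b : MT) (o : ℕ) : ∀ x ∈ word a (o + size b + 1) ++
    [o + size b, o + size b + 1 + size a], ∀ y ∈ word b o, y < x := by
  intro x hx y hy
  have h2 := word_lt _ _ _ hy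
  rcases List.mem_append.1 hx with hx | hx
  · have := word_lt _ _ _ hx; omega
  · simp at hx; omega

theorem pair_mM (a : MT) (o : ℕ) : ∀ x ∈ word a (o + 1), o < x ∧ x < o + 1 + size a := by
  intro x hx
  have := word_lt _ _ _ hx
  omega

def CW (q : List ℕ) (T : MT) : Prop := Cont q (word T 0)

theorem cw_nil {q : List ℕ} (hq : q ≠ []) : ¬ CW q nil := by
  rintro ⟨f, hf, hs⟩
  simp [word] at hs
  exact hq hs

theorem cw_c {q : List ℕ} {x y : ℕ} (hy : y ∈ q) (hxy : x < y) (T : MT) :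
    CW (x :: q) (c T) ↔ CW (x :: q) T :=
  cont_cons hy hxy (fun _ hz => (word_lt _ _ _ hz).2)

theorem cw_Q {u : List ℕ} {lo hi : ℕ} (hu : ∀ x ∈ u, lo < x ∧ x < hi) (hlh : lo < hi) (a b : MT) :
    CW (u ++ [lo, hi]) (p a b) ↔ CW u a ∨ CW (u ++ [lo, hi]) b := by
  have e : u ++ [lo, hi] = (u ++ [lo]) ++ [hi] := by simp
  have := cont_indec (P := u ++ [lo]) (hi := hi) (pairAB a b 0) (by
    intro x hx
    rcases List.mem_append.1 hx with hx | hx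
    · exact (hu x hx).2
    · simp at hx; omega)
  rw [← e] at this
  rw [CW, word, this, cont_mM hu hlh (pair_mM a _) (by omega), cont_word]
  rfl

theorem cw_tau {u v : List ℕ} {lo hi lo' hi' : ℕ} (hu : ∀ x ∈ u, lo < x ∧ x < hi) (hlh : lo < hi)
    (hv : ∀ x ∈ v, lo' < x ∧ x < hi') (hlh' : lo' < hi') (h : hi' < lo) (a b : MT) :
    CW ((u ++ [lo, hi]) ++ (v ++ [lo', hi'])) (p a b) ↔
      CW ((u ++ [lo, hi]) ++ (v ++ [lo', hi'])) a ∨ (CW u a ∧ CW (v ++ [lo', hi']) b) ∨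
      CW ((u ++ [lo, hi]) ++ (v ++ [lo', hi'])) b := by
  have e : u ++ [lo, hi] = (u ++ [lo]) ++ [hi] := by simp
  have e' : v ++ [lo', hi'] = (v ++ [lo']) ++ [hi'] := by simp
  have := cont_skew (P := u ++ [lo]) (hi := hi) (Q := v ++ [lo']) (hj := hi') (pairAB a b 0) (by
    intro x hx
    rcases List.mem_append.1 hx with hx | hx
    · exact (hu x hx).2
    · simp at hx; omega) (by
    intro x hx
    rcases List.mem_append.1 hx with hx | hx
    · exact (hv x hx).2
    · simp at hx; omega) (by
    intro x hx y hy
    rw [← e] at hx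
    rw [← e'] at hy
    have h1 : lo ≤ x := by
      rcases List.mem_append.1 hx with hx | hx
      · exact (hu x hx).1.le
      · simp at hx; omega
    have h2 : y ≤ hi' := by
      rcases List.mem_append.1 hy with hx | hx
      · exact (hv y hx).2.le
      · simp at hx; omega
    omega)
  rw [← e, ← e'] at this
  rw [CW, word, this, cont_mM hu hlh (pair_mM a _) (by omega), cont_word]
  have e2 : (u ++ [lo, hi]) ++ (v ++ [lo', hi']) = ((u ++ [lo, hi]) ++ (v ++ [lo'])) ++ [hi'] := by
    simp
  rw [e2, cont_mM' (y := lo) (z := lo') (by simp) h (by simp) hlh' (pair_mM a _) (by omega),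
    cont_word]
  rfl

end MT
namespace MT

theorem motz_iff (l : List ℕ) : Motz l ↔
    (∀ i j k (hij : i < j) (hjk : j < k) (hk : k < l.length), ¬ (l[i] < l[k] ∧ l[k] < l[j])) ∧
    (∀ a b (hab : a < b) (hb : b + 1 < l.length), ¬ (l[a] < l[b] ∧ l[b] < l[b + 1])) := by
  induction l with
  | nil => simp [Motz]
  | cons x l ih =>
    rw [Motz, ih, List.pairwise_iff_getElem, List.isChain_iff_getElem]
    constructor
    · rintro ⟨h1, h2, h3, h4⟩
      constructor
      · intro i j k hij hjk hk
        obtain ⟨j, rfl⟩ : ∃ j', j = j' + 1 := ⟨j - 1, by omega⟩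
        obtain ⟨k, rfl⟩ : ∃ j', k = j' + 1 := ⟨k - 1, by omega⟩
        simp only [List.length_cons] at hk
        cases i with
        | zero =>
          simpa using h1 j k (by omega) (by omega) (by omega)
        | succ i => simpa using h3 i j k (by omega) (by omega) (by omega)
      · intro i j hij hk
        obtain ⟨j, rfl⟩ : ∃ j', j = j' + 1 := ⟨j - 1, by omega⟩
        simp only [List.length_cons] at hk
        cases i with
        | zero =>
          simpa using h2 j (by omega)
        | succ i => simpa using h4 i j (by omega) (by omega)
    · rintro ⟨h1, h2⟩
      refine ⟨?_, ?_, ?_, ?_⟩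
      · intro i j hi hj hij
        exact h1 0 (i+1) (j+1) (by omega) (by omega) (by simpa using hj)
      · intro i hi
        exact h2 0 (i+1) (by omega) (by simpa using hi)
      · intro i j k hij hjk hk
        exact h1 (i+1) (j+1) (k+1) (by omega) (by omega) (by simpa using hk)
      · intro i j hij hk
        exact h2 (i+1) (j+1) (by omega) (by simpa using hk)

def L {n : ℕ} (π : Equiv.Perm (Fin n)) : List ℕ := List.ofFn (fun i => (π i : ℕ))

theorem L_length {n : ℕ} (π : Equiv.Perm (Fin n)) : (L π).length = n := by simp [L]

theorem L_get {n : ℕ} (π : Equiv.Perm (Fin n)) (i : ℕ) (h : i < (L π).length) :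
    (L π)[i] = (π ⟨i, by simpa [L] using h⟩ : ℕ) := by simp [L]

theorem L_inj {n : ℕ} : Function.Injective (L (n := n)) := by
  intro π σ h
  have := List.ofFn_injective h
  ext i
  exact congrFun this i

theorem L_iv {n : ℕ} (π : Equiv.Perm (Fin n)) : Iv (L π) 0 (0 + n) := by
  constructor
  · rw [L, List.nodup_ofFn]
    intro i j h
    exact π.injective (Fin.ext h)
  · intro x
    simp only [L, List.mem_ofFn']
    constructor
    · rintro ⟨i, rfl⟩
      have := (π i).isLt
      simp
    · rintro ⟨_, h⟩
      exact ⟨π.symm ⟨x, by omega⟩, by simp⟩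

theorem L_surj {n : ℕ} {l : List ℕ} (h : Iv l 0 (0 + n)) : ∃ π : Equiv.Perm (Fin n), L π = l := by
  have hl : l.length = n := by rw [h.length]; omega
  let f : Fin n → Fin n := fun i => ⟨l[i]'(by rw [hl]; exact i.isLt), by
    have := ((h.2 _).1 (List.getElem_mem (l := l) (n := i) (by rw [hl]; exact i.isLt))).2
    simpa using this⟩
  have hf : Function.Injective f := by
    intro i j hij
    have h2 := congrArg Fin.val hij
    simp only [f] at h2
    exact Fin.ext ((List.Nodup.getElem_inj_iff h.1).1 h2)
  refine ⟨Equiv.ofBijective f (Finite.injective_iff_bijective.1 hf), ?_⟩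
  apply List.ext_getElem
  · simp [L, hl]
  · intro i h1 h2
    simp [L, f]

theorem motz_L {n : ℕ} (π : Equiv.Perm (Fin n)) : IsMotzkinPerm π ↔ Motz (L π) := by
  rw [motz_iff]
  unfold IsMotzkinPerm Avoids132 Avoids1_23
  simp only [L_get]
  constructor
  · rintro ⟨h1, h2⟩
    constructor
    · rintro i j k hij hjk hk ⟨h3, h4⟩
      exact h1 ⟨_, _, _, hij, hjk, h3, h4⟩
    · rintro i j hij hj ⟨h3, h4⟩
      rw [L_length] at hj
      exact h2 ⟨_, _, hj, hij, h3, h4⟩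
  · rintro ⟨h1, h2⟩
    constructor
    · rintro ⟨i, j, k, hij, hjk, h3, h4⟩
      exact h1 i j k hij hjk (by rw [L_length]; exact k.isLt) ⟨h3, h4⟩
    · rintro ⟨i, j, hj, hij, h3, h4⟩
      exact h2 i j hij (by rw [L_length]; exact hj) ⟨h3, h4⟩

theorem cont_L {k n : ℕ} (τ : Equiv.Perm (Fin k)) (π : Equiv.Perm (Fin n)) :
    ContainsPatt τ π ↔ Cont (L τ) (L π) := by
  constructor
  · rintro ⟨g, hg, hgi⟩
    let F : ℕ → ℕ := fun v => if h : v < k then (π (g (τ.symm ⟨v, h⟩)) : ℕ) else 0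
    have hF : ∀ i, F (τ i) = (π (g i) : ℕ) := by
      intro i
      simp [F]
    refine ⟨F, ?_, ?_⟩
    · intro x hx y hy hxy
      simp only [L, List.mem_ofFn'] at hx hy
      obtain ⟨i, rfl⟩ := hx
      obtain ⟨j, rfl⟩ := hy
      simp only [hF]
      exact (hgi i j).1 hxy
    · have hlen : ((L τ).map F).length = k := by rw [List.length_map, L_length]
      rw [List.sublist_iff_exists_fin_orderEmbedding_get_eq]
      refine ⟨OrderEmbedding.ofStrictMono
        (fun i => Fin.cast (L_length π).symm (g (Fin.cast hlen i))) ?_, ?_⟩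
      · intro i j hij
        exact hg (show Fin.cast hlen i < Fin.cast hlen j from hij)
      · intro i
        simp only [List.get_eq_getElem, List.getElem_map, L_get, hF]
        rfl
  · rintro ⟨F, hF, hs⟩
    rw [List.sublist_iff_exists_fin_orderEmbedding_get_eq] at hs
    obtain ⟨e, he⟩ := hs
    have hlen : ((L τ).map F).length = k := by rw [List.length_map, L_length]
    let g : Fin k → Fin n := fun i => Fin.cast (L_length π) (e (Fin.cast hlen.symm i))
    have hg : ∀ i, (π (g i) : ℕ) = F (τ i) := by
      intro i
      have := he (Fin.cast hlen.symm i)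
      simp only [List.get_eq_getElem, List.getElem_map, L_get] at this
      exact this.symm
    have hm : ∀ i j, τ i < τ j → π (g i) < π (g j) := by
      intro i j hij
      have := hF (τ i) (by simp [L]) (τ j) (by simp [L]) hij
      rw [← hg, ← hg] at this
      exact this
    refine ⟨g, ?_, ?_⟩
    · intro i j hij
      exact e.strictMono (show Fin.cast hlen.symm i < Fin.cast hlen.symm j from hij)
    · intro i j
      refine ⟨hm i j, fun h => ?_⟩
      rcases lt_trichotomy (τ i) (τ j) with h1 | h1 | h1
      · exact h1
      · rw [τ.injective h1] at h
        exact absurd h (lt_irrefl _)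
      · exact absurd (h.trans (hm j i h1)) (lt_irrefl _)

theorem finite_size (n : ℕ) : {T : MT | size T = n}.Finite := by
  induction n using Nat.strong_induction_on with
  | _ n ih =>
    have h1 : {T : MT | size T < n}.Finite := by
      have : {T : MT | size T < n} = ⋃ i ∈ Set.Iio n, {T : MT | size T = i} := by
        ext T; simp
      rw [this]
      exact (Set.finite_Iio n).biUnion (fun i hi => ih i hi)
    refine (((Set.finite_singleton nil).union (h1.image c)).union
      ((h1.prod h1).image (fun x => p x.1 x.2))).subset ?_
    rintro T hT
    simp only [Set.mem_ofPred_eq] at hT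
    cases T with
    | nil => simp
    | c a =>
      simp only [size] at hT
      exact Or.inl (Or.inr ⟨a, by simp; omega, rfl⟩)
    | p a b =>
      simp only [size] at hT
      exact Or.inr ⟨(a, b), by simp; omega, rfl⟩

noncomputable def trees (n : ℕ) : Finset MT := (finite_size n).toFinset

theorem mem_trees {n : ℕ} {T : MT} : T ∈ trees n ↔ size T = n := by simp [trees]

noncomputable def G (w : MT → ℚ) : PowerSeries ℚ := PowerSeries.mk fun n => ∑ T ∈ trees n, w T

noncomputable def G2 (w : MT → MT → ℚ) : PowerSeries ℚ := PowerSeries.mk fun n =>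
  ∑ x ∈ Finset.HasAntidiagonal.antidiagonal n, ∑ y ∈ trees x.1 ×ˢ trees x.2, w y.1 y.2

theorem G2_mul (u v : MT → ℚ) : G2 (fun a b => u a * v b) = G u * G v := by
  ext n
  rw [PowerSeries.coeff_mul]
  simp only [G2, G, PowerSeries.coeff_mk]
  apply Finset.sum_congr rfl
  intro x _
  rw [Finset.sum_mul_sum, Finset.sum_product]

theorem G2_add (u v : MT → MT → ℚ) : G2 (fun a b => u a b + v a b) = G2 u + G2 v := by
  ext n
  simp [G2, Finset.sum_add_distrib]

theorem G2_sub (u v : MT → MT → ℚ) : G2 (fun a b => u a b - v a b) = G2 u - G2 v := by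
  ext n
  simp [G2, Finset.sum_sub_distrib]

open Classical in
theorem trees_two (n : ℕ) : trees (n + 2) = (trees (n + 1)).image c ∪
    (Finset.HasAntidiagonal.antidiagonal n).biUnion (fun x => (trees x.1 ×ˢ trees x.2).image
      (fun y => p y.1 y.2)) := by
  ext T
  simp only [mem_trees, Finset.mem_union, Finset.mem_image, Finset.mem_biUnion,
    Finset.HasAntidiagonal.mem_antidiagonal, Finset.mem_product]
  constructor
  · intro h
    cases T with
    | nil => simp [size] at h
    | c a => left; exact ⟨a, by simpa [size] using h, rfl⟩
    | p a b =>
      right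
      exact ⟨(size a, size b), by simpa [size] using h, (a, b), ⟨rfl, rfl⟩, rfl⟩
  · rintro (⟨a, h, rfl⟩ | ⟨x, h, y, ⟨h1, h2⟩, rfl⟩)
    · simp [size, h]
    · simp [size, h1, h2, h]

theorem trees_zero : trees 0 = {nil} := by
  ext T
  rw [mem_trees]
  cases T <;> simp [size]

open Classical in
theorem trees_one : trees 1 = (trees 0).image c := by
  ext T
  rw [mem_trees, trees_zero]
  cases T with
  | nil => simp [size]
  | c a => cases a <;> simp [size]
  | p a b => simp [size]

open Classical in
theorem sum_trees_two (w : MT → ℚ) (n : ℕ) : ∑ T ∈ trees (n + 2), w T =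
    ∑ T ∈ trees (n + 1), w (c T) +
    ∑ x ∈ Finset.HasAntidiagonal.antidiagonal n, ∑ y ∈ trees x.1 ×ˢ trees x.2, w (p y.1 y.2) := by
  rw [trees_two, Finset.sum_union, Finset.sum_image, Finset.sum_biUnion]
  · congr 1
    apply Finset.sum_congr rfl
    intro x _
    rw [Finset.sum_image]
    rintro ⟨a, b⟩ _ ⟨a', b'⟩ _ h
    simpa using h
  · intro x _ y _ hxy
    rw [Function.onFun, Finset.disjoint_left]
    intro T h1 h2
    simp only [Finset.mem_image, Finset.mem_product, mem_trees] at h1 h2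
    obtain ⟨⟨a, b⟩, ⟨h3, h4⟩, rfl⟩ := h1
    obtain ⟨⟨a', b'⟩, ⟨h5, h6⟩, h7⟩ := h2
    simp only [p.injEq] at h7
    obtain ⟨rfl, rfl⟩ := h7
    exact hxy (Prod.ext (h3.symm.trans h5) (h4.symm.trans h6))
  · intro a _ b _ h
    simpa using h
  · rw [Finset.disjoint_left]
    intro T h1 h2
    simp only [Finset.mem_image, Finset.mem_biUnion] at h1 h2
    obtain ⟨a, _, rfl⟩ := h1
    obtain ⟨_, _, y, _, h⟩ := h2
    simp at h

open PowerSeries in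
theorem G_rec (w : MT → ℚ) (h0 : w nil = 1) (hc : ∀ a, w (c a) = w a) :
    G w = 1 + X * G w + X ^ 2 * G2 (fun a b => w (p a b)) := by
  ext n
  match n with
  | 0 => simp [G, trees_zero, h0]
  | 1 =>
    have : coeff 1 (X * G w) = coeff 0 (G w) := PowerSeries.coeff_succ_X_mul 0 (G w)
    rw [map_add, map_add, this, PowerSeries.coeff_X_pow_mul']
    classical
    simp [G, trees_one, trees_zero, hc, PowerSeries.coeff_one]
  | n + 2 =>
    rw [map_add, map_add, PowerSeries.coeff_succ_X_mul, PowerSeries.coeff_X_pow_mul']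
    simp [G, G2, sum_trees_two, hc, PowerSeries.coeff_one]

open Classical in
noncomputable def ind (q : List ℕ) (T : MT) : ℚ := if CW q T then 0 else 1

theorem Ngf_eq {k : ℕ} (τ : Equiv.Perm (Fin k)) : Ngf τ = G (ind (L τ)) := by
  classical
  ext n
  simp only [Ngf, G, PowerSeries.coeff_mk]
  have e1 : Nat.card {π : Equiv.Perm (Fin n) // IsMotzkinPerm π ∧ ¬ ContainsPatt τ π}
      = ((trees n).filter (fun T => ¬ CW (L τ) T)).card := by
    rw [← Set.ncard_coe_finset]
    have h1 := Set.InjOn.ncard_image (s := {π : Equiv.Perm (Fin n) | IsMotzkinPerm π ∧ ¬ ContainsPatt τ π})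
      (f := L) L_inj.injOn
    have h2 := Set.InjOn.ncard_image
      (s := (((trees n).filter (fun T => ¬ CW (L τ) T) : Finset MT) : Set MT))
      (f := fun T => word T 0) (fun S _ T _ h => word_inj S T 0 h)
    have h3 : (L '' {π : Equiv.Perm (Fin n) | IsMotzkinPerm π ∧ ¬ ContainsPatt τ π}) =
      (fun T => word T 0) '' (((trees n).filter (fun T => ¬ CW (L τ) T) : Finset MT) : Set MT) := by
      ext l
      simp only [Set.mem_image, Set.mem_ofPred_eq, Finset.coe_filter, mem_trees]
      constructor
      · rintro ⟨π, ⟨hM, hc⟩, rfl⟩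
        obtain ⟨T, hT, hw⟩ := exists_tree n 0 (L π) (L_iv π) ((motz_L π).1 hM)
        refine ⟨T, ⟨hT, ?_⟩, hw⟩
        rw [CW, hw, ← cont_L]
        exact hc
      · rintro ⟨T, ⟨rfl, hc⟩, rfl⟩
        obtain ⟨π, hπ⟩ := L_surj (word_iv T 0)
        refine ⟨π, ⟨?_, ?_⟩, hπ⟩
        · rw [motz_L, hπ]; exact motz_word T 0
        · rw [cont_L, hπ]; exact hc
    rw [← h2, ← h3, h1]
    rfl
  rw [e1, Finset.card_filter]
  push_cast
  apply Finset.sum_congr rfl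
  intro T _
  by_cases h : CW (L τ) T <;> simp [ind, h]

theorem ind_pos {q : List ℕ} {T : MT} (h : CW q T) : ind q T = 0 := if_pos h

theorem ind_neg {q : List ℕ} {T : MT} (h : ¬ CW q T) : ind q T = 1 := if_neg h

theorem ind_congr {q q' : List ℕ} {T T' : MT} (h : CW q T ↔ CW q' T') : ind q T = ind q' T' := by
  by_cases h1 : CW q T
  · rw [ind_pos h1, ind_pos (h.1 h1)]
  · rw [ind_neg h1, ind_neg (fun h2 => h1 (h.2 h2))]

theorem ind_nil {q : List ℕ} (hq : q ≠ []) : ind q nil = 1 := by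
  simp [ind, cw_nil hq]

theorem exists_first {u : List ℕ} {lo hi : ℕ} (v : List ℕ) (hu : ∀ x ∈ u, lo < x ∧ x < hi)
    (hlh : lo < hi) :
    ∃ x q y, (u ++ [lo, hi]) ++ v = x :: q ∧ y ∈ q ∧ x < y := by
  cases u with
  | nil => exact ⟨lo, hi :: v, hi, by simp, by simp, hlh⟩
  | cons x u =>
    exact ⟨x, u ++ [lo, hi] ++ v, hi, by simp, by simp, (hu x (by simp)).2⟩

theorem ind_c {u : List ℕ} {lo hi : ℕ} (v : List ℕ) (hu : ∀ x ∈ u, lo < x ∧ x < hi)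
    (hlh : lo < hi) (T : MT) : ind ((u ++ [lo, hi]) ++ v) (c T) = ind ((u ++ [lo, hi]) ++ v) T := by
  obtain ⟨x, q, y, e, hy, hxy⟩ := exists_first v hu hlh
  rw [e]
  exact ind_congr (cw_c hy hxy T)

open PowerSeries in
theorem G_Q {u : List ℕ} {lo hi : ℕ} (hu : ∀ x ∈ u, lo < x ∧ x < hi) (hlh : lo < hi) :
    G (ind (u ++ [lo, hi])) * (1 - X - X ^ 2 * G (ind u)) = 1 := by
  have h := G_rec (ind (u ++ [lo, hi])) (ind_nil (by simp))
    (fun a => by simpa using ind_c [] hu hlh a)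
  have e : (fun a b => ind (u ++ [lo, hi]) (p a b)) = fun a b => ind u a * ind (u ++ [lo, hi]) b := by
    funext a b
    have hp := cw_Q hu hlh a b
    by_cases h1 : CW u a
    · rw [ind_pos (hp.2 (Or.inl h1)), ind_pos h1, zero_mul]
    · rw [ind_neg h1, one_mul]
      exact ind_congr (by rw [hp]; simp [h1])
  rw [e, G2_mul] at h
  linear_combination h

open PowerSeries in
theorem G_tau {u v : List ℕ} {lo hi lo' hi' : ℕ} (hu : ∀ x ∈ u, lo < x ∧ x < hi) (hlh : lo < hi)
    (hv : ∀ x ∈ v, lo' < x ∧ x < hi') (hlh' : lo' < hi') (h : hi' < lo) :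
    G (ind ((u ++ [lo, hi]) ++ (v ++ [lo', hi']))) *
      (1 - X - X ^ 2 * (G (ind u) + G (ind (v ++ [lo', hi'])))) =
      1 - X ^ 2 * G (ind u) * G (ind (v ++ [lo', hi'])) := by
  have h0 := G_rec (ind ((u ++ [lo, hi]) ++ (v ++ [lo', hi']))) (ind_nil (by simp))
    (fun a => ind_c _ hu hlh a)
  have e : (fun a b => ind ((u ++ [lo, hi]) ++ (v ++ [lo', hi'])) (p a b)) = fun a b =>
      (ind u a * ind ((u ++ [lo, hi]) ++ (v ++ [lo', hi'])) b +
        ind ((u ++ [lo, hi]) ++ (v ++ [lo', hi'])) a * ind (v ++ [lo', hi']) b) -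
      ind u a * ind (v ++ [lo', hi']) b := by
    funext a b
    have k1 : CW ((u ++ [lo, hi]) ++ (v ++ [lo', hi'])) a → CW u a := fun h =>
      cont_sub h (by simp)
    have k2 : CW ((u ++ [lo, hi]) ++ (v ++ [lo', hi'])) b → CW (v ++ [lo', hi']) b := fun h =>
      cont_sub h (List.sublist_append_right _ _)
    have hp := cw_tau hu hlh hv hlh' h a b
    generalize (u ++ [lo, hi]) ++ (v ++ [lo', hi']) = τ at *
    generalize (v ++ [lo', hi']) = Q at *
    by_cases h1 : CW τ a
    · rw [ind_pos (hp.2 (Or.inl h1)), ind_pos h1, ind_pos (k1 h1)]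
      ring
    · by_cases h2 : CW τ b
      · rw [ind_pos (hp.2 (Or.inr (Or.inr h2))), ind_pos h2, ind_pos (k2 h2)]
        ring
      · rw [ind_neg h1, ind_neg h2]
        by_cases h3 : CW u a
        · rw [ind_pos h3]
          by_cases h4 : CW Q b
          · rw [ind_pos h4, ind_pos (hp.2 (Or.inr (Or.inl ⟨h3, h4⟩)))]
            ring
          · rw [ind_neg h4, ind_neg (by rw [hp]; tauto)]
            ring
        · rw [ind_neg h3, ind_neg (by rw [hp]; tauto)]
          ring
  rw [e, G2_sub, G2_add, G2_mul, G2_mul, G2_mul] at h0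
  linear_combination h0

theorem G_shift (q : List ℕ) (d : ℕ) : G (ind (q.map (· + d))) = G (ind q) := by
  congr 1
  funext T
  exact ind_congr (cont_shift q _ d)

end MT
open PowerSeries in
/-- Let `τ = (ρ', t, k, θ', 1, t-1)` be a Motzkin permutation of length `k`, where all entries
of `ρ'` exceed `t` and all entries of `θ'` are less than `t-1`; let `ρ` and `θ` be obtained
from `ρ'` and `θ'` by decreasing each entry by `t`, resp. by `1`, and let
`W = 1/(1 - x - x² N_θ)`. Then `N_τ (1 - x - x²(N_ρ + W)) = 1 - x² N_ρ W`.
(Positions and values are 0-indexed: e.g. the entry `t` sits at position `k-t-1` as value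
`t-1`, the entry `k` at position `k-t` as value `k-1`, the entry `1` at position `k-2` as
value `0`, and the entry `t-1` at position `k-1` as value `t-2`.) -/
theorem Ngf_rho_t_k_theta_1_tm1 (k t : ℕ) (ht : 4 ≤ t) (htk : t + 2 ≤ k)
    (τ : Equiv.Perm (Fin k)) (hτM : IsMotzkinPerm τ)
    (h1 : (τ ⟨k - t - 1, by omega⟩ : ℕ) = t - 1)
    (h2 : (τ ⟨k - t, by omega⟩ : ℕ) = k - 1)
    (h3 : (τ ⟨k - 2, by omega⟩ : ℕ) = 0)
    (h4 : (τ ⟨k - 1, by omega⟩ : ℕ) = t - 2)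
    (h5 : ∀ i : Fin k, (i : ℕ) < k - t - 1 → t ≤ (τ i : ℕ))
    (h6 : ∀ i : Fin k, k - t + 1 ≤ (i : ℕ) → (i : ℕ) ≤ k - 3 →
      1 ≤ (τ i : ℕ) ∧ (τ i : ℕ) ≤ t - 3)
    (ρ : Equiv.Perm (Fin (k - t - 1)))
    (hρ : ∀ i : Fin (k - t - 1),
      (ρ i : ℕ) + t = (τ ⟨(i : ℕ), by have := i.isLt; omega⟩ : ℕ))
    (θ : Equiv.Perm (Fin (t - 3)))
    (hθ : ∀ i : Fin (t - 3),
      (θ i : ℕ) + 1 = (τ ⟨k - t + 1 + (i : ℕ), by have := i.isLt; omega⟩ : ℕ))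
    (W : PowerSeries ℚ) (hW : W * (1 - X - X ^ 2 * Ngf θ) = 1) :
    Ngf τ * (1 - X - X ^ 2 * (Ngf ρ + W)) = 1 - X ^ 2 * Ngf ρ * W := by

  have hθb : ∀ x ∈ (MT.L θ).map (· + 1), 0 < x ∧ x < t - 2 := by
    intro x hx
    simp only [List.mem_map] at hx
    obtain ⟨y, hy, rfl⟩ := hx
    have := ((MT.L_iv θ).2 y).1 hy
    omega
  have hρb : ∀ x ∈ (MT.L ρ).map (· + t), t - 1 < x ∧ x < k - 1 := by
    intro x hx
    simp only [List.mem_map] at hx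
    obtain ⟨y, hy, rfl⟩ := hx
    have := ((MT.L_iv ρ).2 y).1 hy
    omega
  have hL : MT.L τ = ((MT.L ρ).map (· + t) ++ [t - 1, k - 1]) ++
      ((MT.L θ).map (· + 1) ++ [0, t - 2]) := by
    apply List.ext_getElem
    · simp [MT.L_length]; omega
    · intro i hi hi'
      rw [MT.L_get]
      rw [MT.L_length] at hi
      simp only [List.getElem_append, List.length_append, List.length_map, MT.L_length,
        List.length_cons, List.length_nil, List.getElem_map, MT.L_get]
      split_ifs with c1 c2 c3
      · exact (hρ ⟨i, c2⟩).symm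
      · have : i = k - t - 1 ∨ i = k - t := by omega
        rcases this with rfl | rfl
        · rw [h1]; simp
        · have e : k - t - (k - t - 1) = 1 := by omega
          rw [h2]; simp [e]
      · have := hθ ⟨i - (k - t - 1 + (0 + 1 + 1)), c3⟩
        rw [this]
        congr 3
        simp only
        omega
      · have : i = k - 2 ∨ i = k - 1 := by omega
        rcases this with rfl | rfl
        · have e : k - 2 - (k - t - 1 + (0 + 1 + 1)) - (t - 3) = 0 := by omega
          rw [h3]; simp only [e]; rfl
        · have e : k - 1 - (k - t - 1 + (0 + 1 + 1)) - (t - 3) = 1 := by omega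
          rw [h4]; simp only [e]; rfl
  have hQ := MT.G_Q hθb (by omega : 0 < t - 2)
  have hT := MT.G_tau hρb (by omega) hθb (by omega : 0 < t - 2) (by omega)
  rw [← hL, MT.G_shift, ← MT.Ngf_eq, ← MT.Ngf_eq] at hT
  rw [MT.G_shift, ← MT.Ngf_eq] at hQ
  have hWQ : W = MT.G (MT.ind ((MT.L θ).map (· + 1) ++ [0, t - 2])) := by
    linear_combination (MT.G (MT.ind ((MT.L θ).map (· + 1) ++ [0, t - 2]))) * hW - W * hQ
  rw [hWQ]
  exact hT
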